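/- Under the stated hypotheses, v(p) → +∞ as p → 0⁺, v(p) → 0 as p → b⁻, and v′(p) → −√π/(2·√r·b·(1−b)) as p → b⁻. -/

import Mathlib

/-- The standard normal density `φ(z) = exp(-z²/2)/√(2π)`. -/
noncomputable def npdf (z : ℝ) : ℝ := (Real.sqrt (2 * Real.pi))⁻¹ * Real.exp (-z ^ 2 / 2)

/-- The standard normal distribution function `Φ(y) = ∫_{-∞}^y φ(z) dz`. -/
noncomputable def ncdf (y : ℝ) : ℝ := ∫ z in Set.Iic y, npdf z

/-- The standard normal tail function `Ψ(y) = 1 - Φ(y)`. -/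
noncomputable def ntail (y : ℝ) : ℝ := 1 - ncdf y

/-- The function `F(y) = φ(y) - y·Ψ(y)`. -/
noncomputable def Fstat (y : ℝ) : ℝ := npdf y - y * ntail y

open MeasureTheory Filter Topology in
lemma npdf_eq_gauss : npdf = ProbabilityTheory.gaussianPDFReal 0 1 := by
  funext z
  simp [npdf, ProbabilityTheory.gaussianPDFReal]

lemma npdf_cont : Continuous npdf := by
  unfold npdf
  fun_prop

lemma npdf_pos (z : ℝ) : 0 < npdf z := by
  unfold npdf
  positivity

lemma npdf_integrable : MeasureTheory.Integrable npdf := by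
  rw [npdf_eq_gauss]
  exact ProbabilityTheory.integrable_gaussianPDFReal 0 1

lemma npdf_integral : ∫ z, npdf z = 1 := by
  rw [npdf_eq_gauss]
  exact ProbabilityTheory.integral_gaussianPDFReal_eq_one 0 one_ne_zero

lemma ntail_hasDerivAt (y : ℝ) : HasDerivAt ntail (-npdf y) y := by
  have h1 : ntail = fun y => 1 - (ncdf 0 + ∫ z in (0:ℝ)..y, npdf z) := by
    funext y
    have := intervalIntegral.integral_Iic_sub_Iic (f := npdf) (a := 0) (b := y)
      (μ := MeasureTheory.volume) npdf_integrable.integrableOn npdf_integrable.integrableOn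
    unfold ntail ncdf
    linarith
  rw [h1]
  have h2 : HasDerivAt (fun y => ∫ z in (0:ℝ)..y, npdf z) (npdf y) y :=
    intervalIntegral.integral_hasDerivAt_right (npdf_cont.intervalIntegrable _ _)
      (npdf_cont.stronglyMeasurableAtFilter _ _) npdf_cont.continuousAt
  exact (h2.const_add (ncdf 0)).const_sub 1

lemma ntail_cont : Continuous ntail :=
  continuous_iff_continuousAt.2 fun y => (ntail_hasDerivAt y).continuousAt

lemma ntail_strictAnti : StrictAnti ntail :=
  strictAnti_of_deriv_neg fun y => by
    rw [(ntail_hasDerivAt y).deriv]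
    linarith [npdf_pos y]

lemma ntail_eq (y : ℝ) : ntail y = ∫ z in Set.Ioi y, npdf z := by
  have := intervalIntegral.integral_Iic_add_Ioi (f := npdf) (b := y)
    (μ := MeasureTheory.volume) npdf_integrable.integrableOn npdf_integrable.integrableOn
  rw [npdf_integral] at this
  unfold ntail ncdf
  linarith

lemma ntail_pos (y : ℝ) : 0 < ntail y := by
  have h1 : 0 ≤ ntail (y + 1) := by
    rw [ntail_eq]
    exact MeasureTheory.integral_nonneg fun z => (npdf_pos z).le
  have h2 : ntail (y + 1) < ntail y := ntail_strictAnti (by linarith)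
  linarith

lemma ntail_zero : ntail 0 = 1 / 2 := by
  have h1 := ntail_eq 0
  have h2 := integral_comp_neg_Iic (0:ℝ) npdf
  have h3 : (fun x => npdf (-x)) = npdf := by
    funext x
    simp [npdf]
  simp only [h3, neg_zero] at h2
  have h4 : (∫ z in Set.Iic (0:ℝ), npdf z) = ntail 0 := by
    rw [h1, ← h2]
  have h5 : ntail 0 = 1 - ∫ z in Set.Iic (0:ℝ), npdf z := rfl
  linarith

open Filter Topology in
lemma tendsto_of_ntail {s c : ℝ} (hs : 0 < s) {v : ℝ → ℝ} {l : Filter ℝ}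
    (h : Tendsto (fun p => ntail (s * v p)) l (𝓝 (ntail (s * c)))) : Tendsto v l (𝓝 c) := by
  rw [tendsto_order]
  constructor
  · intro a ha
    have h1 : ntail (s * c) < ntail (s * a) := ntail_strictAnti (by gcongr)
    filter_upwards [h.eventually (gt_mem_nhds h1)] with p hp
    exact lt_of_mul_lt_mul_left (ntail_strictAnti.lt_iff_gt.1 hp) hs.le
  · intro a ha
    have h1 : ntail (s * a) < ntail (s * c) := ntail_strictAnti (by gcongr)
    filter_upwards [h.eventually (lt_mem_nhds h1)] with p hp
    exact lt_of_mul_lt_mul_left (ntail_strictAnti.lt_iff_gt.1 hp) hs.le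

/-- v(p) → +∞ as p → 0+, v(p) → 0 as p → b−, and
v′(p) → −√π/(2√r·b·(1−b)) as p → b−. -/
theorem v_boundary (r b : ℝ) (v : ℝ → ℝ) (hr : 0 < r) (hb : b ∈ Set.Ioo (0:ℝ) 1)
    (hv : ∀ p ∈ Set.Ioo (0:ℝ) b, 0 < v p ∧
      ntail (Real.sqrt (2*r) * v p) = (1 - b) * p / (2 * b * (1 - p))) :
    Filter.Tendsto v (nhdsWithin 0 (Set.Ioo 0 b)) Filter.atTop ∧
    Filter.Tendsto v (nhdsWithin b (Set.Ioo 0 b)) (nhds 0) ∧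
    Filter.Tendsto (deriv v) (nhdsWithin b (Set.Ioo 0 b))
      (nhds (-(Real.sqrt Real.pi / (2 * Real.sqrt r * b * (1 - b))))) := by
  obtain ⟨hb0, hb1⟩ := hb
  set s := Real.sqrt (2 * r) with hs_def
  have hs : 0 < s := by positivity
  have hb1' : 0 < 1 - b := by linarith
  have qc : ∀ p : ℝ, p < 1 →
      ContinuousAt (fun p : ℝ => (1 - b) * p / (2 * b * (1 - p))) p := by
    intro p hp
    have : 2 * b * (1 - p) ≠ 0 := by
      have : 0 < 1 - p := by linarith
      positivity
    fun_prop (disch := assumption)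
  have hT : ∀ x : ℝ, x < 1 → Filter.Tendsto (fun p => ntail (s * v p))
      (nhdsWithin x (Set.Ioo 0 b)) (nhds ((1 - b) * x / (2 * b * (1 - x)))) := by
    intro x hx
    refine Filter.Tendsto.congr' ?_ ((qc x hx).tendsto.mono_left nhdsWithin_le_nhds)
    filter_upwards [self_mem_nhdsWithin] with p hp
    exact (hv p hp).2.symm
  have hv0 : Filter.Tendsto v (nhdsWithin b (Set.Ioo 0 b)) (nhds 0) := by
    apply tendsto_of_ntail hs
    convert hT b hb1 using 2
    rw [mul_zero, ntail_zero]
    field_simp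
  refine ⟨?_, hv0, ?_⟩
  · rw [Filter.tendsto_atTop]
    intro M
    have h0 := hT 0 one_pos
    rw [mul_zero, zero_div] at h0
    filter_upwards [h0.eventually (gt_mem_nhds (ntail_pos (s * M)))] with p hp
    exact (lt_of_mul_lt_mul_left (ntail_strictAnti.lt_iff_gt.1 hp) hs.le).le
  · set D : ℝ → ℝ := fun y => 2 * b * (1 - b) * (-npdf (s * y) * s) /
      ((1 - b) + 2 * b * ntail (s * y)) ^ 2 with hD
    have hpos : ∀ y, 0 < (1 - b) + 2 * b * ntail (s * y) := fun y => by
      have := ntail_pos (s * y)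
      positivity
    have hder : ∀ y, HasDerivAt
        (fun y => 2 * b * ntail (s * y) / ((1 - b) + 2 * b * ntail (s * y))) (D y) y := by
      intro y
      have h1 : HasDerivAt (fun y => ntail (s * y)) (-npdf (s * y) * s) y := by
        have := (ntail_hasDerivAt (s * y)).comp y ((hasDerivAt_id y).const_mul s)
        simpa [Function.comp_def] using this
      have h2 := h1.const_mul (2 * b)
      have h3 := h2.div (h2.const_add (1 - b)) (hpos y).ne'
      refine h3.congr_deriv ?_
      change _ = 2 * b * (1 - b) * (-npdf (s * y) * s) / ((1 - b) + 2 * b * ntail (s * y)) ^ 2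
      congr 1
      ring
    have hD0 : ∀ y, D y ≠ 0 := by
      intro y
      have h1 := npdf_pos (s * y)
      have h2 := hpos y
      have : D y = -(2 * b * (1 - b) * (npdf (s * y) * s) /
        ((1 - b) + 2 * b * ntail (s * y)) ^ 2) := by
        simp only [hD]
        ring
      rw [this]
      exact neg_ne_zero.2 (by positivity)
    have hdv : ∀ p ∈ Set.Ioo (0:ℝ) b, deriv v p = (D (v p))⁻¹ := by
      intro p hp
      have hnb : Set.Ioo (0:ℝ) b ∈ nhds p := isOpen_Ioo.mem_nhds hp
      have hcont : ContinuousAt v p := by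
        have h := hT p (hp.2.trans hb1)
        rw [nhdsWithin_eq_nhds.2 hnb, ← (hv p hp).2] at h
        exact tendsto_of_ntail hs h
      refine (HasDerivAt.of_local_left_inverse hcont (hder (v p)) (hD0 _) ?_).deriv
      filter_upwards [hnb] with x hx
      have hx1 : 0 < 1 - x := by linarith [hx.2]
      rw [(hv x hx).2]
      have h2 : (1 - b) + 2 * b * ((1 - b) * x / (2 * b * (1 - x))) = (1 - b) / (1 - x) := by
        field_simp
        ring
      rw [h2]
      field_simp
    have hDc : ContinuousAt D 0 := by
      have h1 := npdf_cont
      have h2 := ntail_cont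
      have : Continuous D := by
        simp only [hD]
        exact Continuous.div (by fun_prop) (by fun_prop) fun y => (pow_pos (hpos y) 2).ne'
      exact this.continuousAt
    have hlim : Filter.Tendsto (fun p => (D (v p))⁻¹) (nhdsWithin b (Set.Ioo 0 b))
        (nhds (D 0)⁻¹) := (hDc.tendsto.comp hv0).inv₀ (hD0 0)
    have hval : (D 0)⁻¹ = -(Real.sqrt Real.pi / (2 * Real.sqrt r * b * (1 - b))) := by
      have hpi : 0 < Real.sqrt Real.pi := Real.sqrt_pos.2 Real.pi_pos
      have hr' : 0 < Real.sqrt r := Real.sqrt_pos.2 hr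
      have h2' : 0 < Real.sqrt 2 := by positivity
      simp only [hD, mul_zero, ntail_zero]
      have e1 : (1 - b) + 2 * b * (1 / 2) = 1 := by ring
      have e2 : npdf 0 = (Real.sqrt 2 * Real.sqrt Real.pi)⁻¹ := by
        simp [npdf]
      have e3 : s = Real.sqrt 2 * Real.sqrt r := by
        rw [hs_def, Real.sqrt_mul (by norm_num)]
      rw [e1, e2, e3]
      field_simp
    rw [← hval]
    refine hlim.congr' ?_
    filter_upwards [self_mem_nhdsWithin] with p hp
    exact (hdv p hp).symm
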